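/- arXiv:2107.02237 — 2 statements merged into one kernel-verified Lean document; each statement's English description precedes it below -/
import Mathlib

section
/- Let X be a measurable space equipped with a probability measure μ, let A = {1,…,K} be a finite action set, and let f, f★ : X × A → [0,1] be measurable. For a measurable policy π : X → A define L(π) := ∫ f★(x, π(x)) dμ(x), and let Δ := ∫ D_Δ(f★(x,·) ‖ f(x,·)) dμ(x). Then for every measurable policy π : X → A, ∫ (f★(x, π(x)) + f(x, π(x))) dμ(x) ≤ Δ + 4·L(π). -/
open MeasureTheory

lemma add_le_sq_sub_div_add_add_four_mul {p q : ℝ} (hp : 0 ≤ p) (hq : 0 ≤ q) :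
    p + q ≤ (p - q) ^ 2 / (p + q) + 4 * p := by
  rcases (add_nonneg hp hq).eq_or_lt with h | h
  · rw [← h]
    simpa using hp
  · rw [← sub_le_iff_le_add, le_div_iff₀ h]
    nlinarith [sq_nonneg p]

lemma sq_sub_div_add_mem_Icc {p q : ℝ} (hp : p ∈ Set.Icc (0:ℝ) 1) (hq : q ∈ Set.Icc (0:ℝ) 1) :
    (p - q) ^ 2 / (p + q) ∈ Set.Icc (0:ℝ) 2 := by
  obtain ⟨hp0, hp1⟩ := hp
  obtain ⟨hq0, hq1⟩ := hq
  refine ⟨by positivity, div_le_of_le_mul₀ (by positivity) (by norm_num) ?_⟩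
  nlinarith [mul_nonneg hp0 hq0, mul_nonneg hp0 (sub_nonneg.2 hp1),
    mul_nonneg hq0 (sub_nonneg.2 hq1)]

lemma measurable_eval_policy {X A : Type*} [MeasurableSpace X] [MeasurableSpace A] [Countable A]
    [MeasurableSingletonClass A] {g : X → A → ℝ} (hg : ∀ a, Measurable fun x => g x a)
    {π : X → A} (hπ : Measurable π) : Measurable fun x => g x (π x) :=
  (measurable_from_prod_countable_left (f := fun z : X × A => g z.1 z.2) hg).comp
    (measurable_id.prodMk hπ)

/-- Lemma `lem:fhat_to_fstar`: for any policy `π`,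
`E[f★(x,π(x)) + f(x,π(x))] ≤ Δ + 4·L(π)`. Ratios with zero denominator are `0` by Lean's
convention `x / 0 = 0`. -/
theorem stmt_7 {X : Type*} [MeasurableSpace X] (μ : Measure X) [IsProbabilityMeasure μ]
    (K : ℕ) (hK : 1 ≤ K)
    (f fstar : X → Fin K → ℝ)
    (hfm : ∀ a, Measurable fun x => f x a) (hfsm : ∀ a, Measurable fun x => fstar x a)
    (hf : ∀ x a, f x a ∈ Set.Icc (0:ℝ) 1) (hfs : ∀ x a, fstar x a ∈ Set.Icc (0:ℝ) 1)
    (Δ : ℝ)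
    (hΔ : Δ = ∫ x, ∑ a, (fstar x a - f x a) ^ 2 / (fstar x a + f x a) ∂μ)
    (π : X → Fin K) (hπm : Measurable π) :
    (∫ x, (fstar x (π x) + f x (π x)) ∂μ) ≤ Δ + 4 * ∫ x, fstar x (π x) ∂μ := by
  have hF : Integrable (fun x => f x (π x)) μ :=
    .of_mem_Icc 0 1 (measurable_eval_policy hfm hπm).aemeasurable (.of_forall fun x => hf x _)
  have hFs : Integrable (fun x => fstar x (π x)) μ :=
    .of_mem_Icc 0 1 (measurable_eval_policy hfsm hπm).aemeasurable (.of_forall fun x => hfs x _)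
  have hD : Integrable
      (fun x => ∑ a, (fstar x a - f x a) ^ 2 / (fstar x a + f x a)) μ :=
    integrable_finsetSum _ fun a _ => .of_mem_Icc 0 2
      ((((hfsm a).sub (hfm a)).pow_const 2).div ((hfsm a).add (hfm a))).aemeasurable
      (.of_forall fun x => sq_sub_div_add_mem_Icc (hfs x a) (hf x a))
  rw [hΔ, ← integral_const_mul, ← integral_add hD (hFs.const_mul 4)]
  refine integral_mono (hFs.add hF) (hD.add (hFs.const_mul 4)) fun x => ?_
  refine (add_le_sq_sub_div_add_add_four_mul (hfs x _).1 (hf x _).1).trans ?_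
  gcongr
  exact Finset.single_le_sum (f := fun a => (fstar x a - f x a) ^ 2 / (fstar x a + f x a))
    (fun a _ => (sq_sub_div_add_mem_Icc (hfs x a) (hf x a)).1) (Finset.mem_univ (π x))
end

section
/- Let X be a measurable space equipped with a probability measure μ, let A = {1,…,K} be a finite action set, and let f, f★ : X × A → [0,1] be measurable. Let π_f, π★ : X → A be measurable maps such that for every x, π_f(x) ∈ argmin_a f(x,a) and π★(x) ∈ argmin_a f★(x,a). Define L(π) := ∫ f★(x, π(x)) dμ(x), L★ := L(π★), and Δ := ∫ D_Δ(f★(x,·) ‖ f(x,·)) dμ(x). Then L(π_f) − L★ ≤ 2·√Δ · √( 2·Δ + 4·(L(π_f) + L★) ). -/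
open MeasureTheory

/-- Integral form of the Cauchy–Schwarz inequality for `g ^ 2 ≤ d * e`. -/
lemma sq_integral_le_mul_integral {X : Type*} [MeasurableSpace X] {μ : Measure X}
    {g d e : X → ℝ} (hg : Integrable g μ) (hd : Integrable d μ) (he : Integrable e μ)
    (hd0 : ∀ x, 0 ≤ d x) (he0 : ∀ x, 0 ≤ e x) (h : ∀ x, g x ^ 2 ≤ d x * e x) :
    (∫ x, g x ∂μ) ^ 2 ≤ (∫ x, d x ∂μ) * ∫ x, e x ∂μ := by
  have key : ∀ t : ℝ, 0 ≤ (∫ x, d x ∂μ) * (t * t) + 2 * (∫ x, g x ∂μ) * t + ∫ x, e x ∂μ := by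
    intro t
    have hint : ∫ x, (d x * (t * t) + g x * (2 * t) + e x) ∂μ
        = (∫ x, d x ∂μ) * (t * t) + (∫ x, g x ∂μ) * (2 * t) + ∫ x, e x ∂μ := by
      have hdg : Integrable (fun x => d x * (t * t) + g x * (2 * t)) μ :=
        (hd.mul_const _).add (hg.mul_const _)
      rw [integral_add hdg he, integral_add (hd.mul_const _) (hg.mul_const _), integral_mul_const, integral_mul_const]
    have hnonneg : 0 ≤ ∫ x, (d x * (t * t) + g x * (2 * t) + e x) ∂μ := by
      refine integral_nonneg fun x => ?_
      have hsq : (g x * (2 * t)) ^ 2 ≤ (d x * (t * t) + e x) ^ 2 := by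
        nlinarith [sq_nonneg (d x * (t * t) - e x), mul_le_mul_of_nonneg_right (h x) (sq_nonneg t)]
      have hs : 0 ≤ d x * (t * t) + e x :=
        add_nonneg (mul_nonneg (hd0 x) (mul_self_nonneg t)) (he0 x)
      have := (abs_le_of_sq_le_sq' hsq hs).1
      simp only [Pi.zero_apply]
      linarith
    linarith
  have := discrim_le_zero key
  rw [discrim] at this
  linarith

lemma triangular_term_nonneg {u v : ℝ} (hu : 0 ≤ u) (hv : 0 ≤ v) :
    0 ≤ (u - v) ^ 2 / (u + v) := by positivity

lemma triangular_term_mul_add {u v : ℝ} (hu : 0 ≤ u) (hv : 0 ≤ v) :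
    (u - v) ^ 2 / (u + v) * (u + v) = (u - v) ^ 2 := by
  rcases eq_or_ne (u + v) 0 with h | h
  · have hu0 : u = 0 := by linarith
    have hv0 : v = 0 := by linarith
    simp [hu0, hv0]
  · exact div_mul_cancel₀ _ h

lemma triangular_term_le_one {u v : ℝ} (hu : u ∈ Set.Icc (0 : ℝ) 1) (hv : v ∈ Set.Icc (0 : ℝ) 1) :
    (u - v) ^ 2 / (u + v) ≤ 1 := by
  obtain ⟨hu0, hu1⟩ := hu
  obtain ⟨hv0, hv1⟩ := hv
  refine div_le_one_of_le₀ ?_ (by positivity)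
  nlinarith [mul_nonneg hu0 hv0, mul_nonneg hu0 (sub_nonneg.2 hu1),
    mul_nonneg hv0 (sub_nonneg.2 hv1)]

lemma right_le_three_mul_left_add_triangular_term {u v : ℝ} (hu : 0 ≤ u) (hv : 0 ≤ v) :
    v ≤ 3 * u + (u - v) ^ 2 / (u + v) := by
  rcases (add_nonneg hu hv).eq_or_lt with h | h
  · have hv0 : v = 0 := by linarith
    rw [hv0]
    positivity
  · rw [← sub_le_iff_le_add', le_div_iff₀ h]
    nlinarith

/-- The squared loss gap of a greedy action is controlled by the triangular discrimination. -/
lemma sq_gap_le_triangular {A : Type*} [Fintype A] [DecidableEq A] {p q : A → ℝ}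
    (hp : ∀ a, 0 ≤ p a) (hq : ∀ a, 0 ≤ q a) {i j : A} (hi : q i ≤ q j) (hj : p j ≤ p i) :
    (p i - p j) ^ 2 ≤ (∑ a, (p a - q a) ^ 2 / (p a + q a)) *
      (∑ a, (p a - q a) ^ 2 / (p a + q a) + 4 * (p i + p j)) := by
  have hnn : ∀ a, 0 ≤ (p a - q a) ^ 2 / (p a + q a) :=
    fun a => triangular_term_nonneg (hp a) (hq a)
  have hD : 0 ≤ ∑ a, (p a - q a) ^ 2 / (p a + q a) := Finset.sum_nonneg fun a _ => hnn a
  rcases eq_or_ne i j with rfl | hij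
  · rw [sub_self, zero_pow two_ne_zero]
    exact mul_nonneg hD (by linarith [hp i])
  · have hle : (p i - q i) ^ 2 / (p i + q i) + (p j - q j) ^ 2 / (p j + q j)
        ≤ ∑ a, (p a - q a) ^ 2 / (p a + q a) := by
      rw [← Finset.sum_pair (f := fun a => (p a - q a) ^ 2 / (p a + q a)) hij]
      exact Finset.sum_le_sum_of_subset_of_nonneg (Finset.subset_univ _) fun a _ _ => hnn a
    have hqi := right_le_three_mul_left_add_triangular_term (hp i) (hq i)
    have hqj := right_le_three_mul_left_add_triangular_term (hp j) (hq j)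
    have hmi := triangular_term_mul_add (hp i) (hq i)
    have hmj := triangular_term_mul_add (hp j) (hq j)
    have hni := hnn i
    have hnj := hnn j
    have hpi := hp i
    have hpj := hp j
    have hqi0 := hq i
    have hqj0 := hq j
    generalize (p i - q i) ^ 2 / (p i + q i) = s at *
    generalize (p j - q j) ^ 2 / (p j + q j) = r at *
    generalize ∑ a, (p a - q a) ^ 2 / (p a + q a) = D at *
    have hgap : (p i - p j) ^ 2 ≤ ((p i - q i) + (q j - p j)) ^ 2 :=
      pow_le_pow_left₀ (by linarith) (by linarith) 2
    have hcs : ((p i - q i) + (q j - p j)) ^ 2 ≤ (s + r) * ((p i + q i) + (p j + q j)) := by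
      have hr : (q j - p j) ^ 2 = r * (p j + q j) := by rw [hmj]; ring
      have hcross : (2 * ((p i - q i) * (q j - p j))) ^ 2
          ≤ (s * (p j + q j) + r * (p i + q i)) ^ 2 := by
        have : (2 * ((p i - q i) * (q j - p j))) ^ 2
            = 4 * (s * (p i + q i)) * (r * (p j + q j)) := by
          rw [hmi, ← hr]; ring
        rw [this]
        nlinarith [sq_nonneg (s * (p j + q j) - r * (p i + q i))]
      have := abs_le_of_sq_le_sq hcross (by positivity)
      have := (abs_le.1 this).2
      nlinarith
    calc (p i - p j) ^ 2 ≤ (s + r) * ((p i + q i) + (p j + q j)) := hgap.trans hcs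
      _ ≤ D * (D + 4 * (p i + p j)) :=
        mul_le_mul hle (by linarith) (by positivity) hD

/-- First inequality in `eq:cauchy_intermediate`:
`L(π_f) − L★ ≤ 2√Δ·√(2Δ + 4(L(π_f) + L★))`. Ratios with zero denominator are `0` by
Lean's convention `x / 0 = 0`. -/
theorem stmt_19 {X : Type*} [MeasurableSpace X] (μ : Measure X) [IsProbabilityMeasure μ]
    (K : ℕ) (hK : 1 ≤ K)
    (f fstar : X → Fin K → ℝ)
    (hfm : ∀ a, Measurable fun x => f x a) (hfsm : ∀ a, Measurable fun x => fstar x a)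
    (hf : ∀ x a, f x a ∈ Set.Icc (0:ℝ) 1) (hfs : ∀ x a, fstar x a ∈ Set.Icc (0:ℝ) 1)
    (πf πs : X → Fin K) (hπfm : Measurable πf) (hπsm : Measurable πs)
    (hπf : ∀ x a, f x (πf x) ≤ f x a) (hπs : ∀ x a, fstar x (πs x) ≤ fstar x a)
    (Lstar Δ : ℝ)
    (hLstar : Lstar = ∫ x, fstar x (πs x) ∂μ)
    (hΔ : Δ = ∫ x, ∑ a, (fstar x a - f x a) ^ 2 / (fstar x a + f x a) ∂μ) :
    (∫ x, fstar x (πf x) ∂μ) - Lstar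
      ≤ 2 * Real.sqrt Δ
          * Real.sqrt (2 * Δ + 4 * ((∫ x, fstar x (πf x) ∂μ) + Lstar)) := by
  subst hLstar hΔ
  have hpm : ∀ π : X → Fin K, Measurable π → Integrable (fun x => fstar x (π x)) μ := by
    intro π hπ
    have hm : Measurable fun z : X × Fin K => fstar z.1 z.2 :=
      measurable_from_prod_countable_left hfsm
    refine Integrable.of_bound (hm.comp (measurable_id.prodMk hπ)).aestronglyMeasurable 1
      (Filter.Eventually.of_forall fun x => ?_)
    rw [Real.norm_of_nonneg (hfs x _).1]
    exact (hfs x _).2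
  have hdi : Integrable (fun x => ∑ a, (fstar x a - f x a) ^ 2 / (fstar x a + f x a)) μ := by
    refine integrable_finsetSum _ fun a _ => Integrable.of_bound
      ((((hfsm a).sub (hfm a)).pow_const 2).div ((hfsm a).add (hfm a))).aestronglyMeasurable 1
      (Filter.Eventually.of_forall fun x => ?_)
    rw [Real.norm_of_nonneg (triangular_term_nonneg (hfs x a).1 (hf x a).1)]
    exact triangular_term_le_one (hfs x a) (hf x a)
  have hif := hpm πf hπfm
  have his := hpm πs hπsm
  have hd0 : ∀ x, 0 ≤ ∑ a, (fstar x a - f x a) ^ 2 / (fstar x a + f x a) := fun x =>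
    Finset.sum_nonneg fun a _ => triangular_term_nonneg (hfs x a).1 (hf x a).1
  have hsq := sq_integral_le_mul_integral (hif.sub his) hdi
    (hdi.add ((hif.add his).const_mul 4)) hd0
    (fun x => add_nonneg (hd0 x)
      (mul_nonneg zero_le_four (add_nonneg (hfs x (πf x)).1 (hfs x (πs x)).1)))
    (fun x => sq_gap_le_triangular (fun a => (hfs x a).1) (fun a => (hf x a).1)
      (hπf x (πs x)) (hπs x (πf x)))
  rw [integral_sub' hif his, integral_add' hdi ((hif.add his).const_mul 4), integral_const_mul,
    integral_add' hif his] at hsq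
  have hΔ0 := integral_nonneg (μ := μ) (Pi.le_def.2 hd0)
  have hf0 := integral_nonneg (μ := μ) (Pi.le_def.2 (fun x => (hfs x (πf x)).1))
  have hs0 := integral_nonneg (μ := μ) (Pi.le_def.2 (fun x => (hfs x (πs x)).1))
  generalize ∫ x, ∑ a, (fstar x a - f x a) ^ 2 / (fstar x a + f x a) ∂μ = D at *
  generalize ∫ x, fstar x (πf x) ∂μ = L at *
  generalize ∫ x, fstar x (πs x) ∂μ = M at *
  refine (abs_le_of_sq_le_sq' ?_ (by positivity)).2
  rw [mul_pow, mul_pow, Real.sq_sqrt hΔ0, Real.sq_sqrt (by positivity)]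
  nlinarith [mul_nonneg hΔ0 hΔ0, mul_nonneg hΔ0 (add_nonneg hf0 hs0)]
end
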